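/- arXiv:2004.09640 — 6 statements merged into one kernel-verified Lean document; each statement's English description precedes it below -/
import Mathlib

section
/- Let α > 0, let ω < ρ̄ be reals, and let p̲ ∈ ℝ. Let f, h : ℝ → ℝ be differentiable, and let φ : ℝ → ℝ be continuous on [ω, ρ̄] and differentiable on (ω, ρ̄) with φ(ω) = p̲. Assume (i) φ(y) − f'(y) ≥ (1/α)·h'(φ(y))·φ'(y) for all y ∈ (ω, ρ̄), and (ii) p̲·ω − f(ω) ≥ (1/α)·h(p̲). Then for every ρ ∈ [ω, ρ̄], p̲·ω + ∫_ω^ρ φ(y) dy − f(ρ) ≥ (1/α)·h(φ(ρ)). -/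
/-- Key analytic step of Theorem 1: a pricing function `φ` satisfying the
differential inequality on the increasing segment together with the flat-segment
condition guarantees, at every final utilization `ρ ∈ [ω, ρ̄]`, that the online
welfare `p̲ ω + ∫_ω^ρ φ − f ρ` is at least `(1/α) h (φ ρ)`. -/
theorem stmt7 (α ω ρbar plow : ℝ) (hα : 0 < α) (hωρ : ω < ρbar)
    (f h f' h' : ℝ → ℝ)
    (hf : ∀ y : ℝ, HasDerivAt f (f' y) y)
    (hh : ∀ p : ℝ, HasDerivAt h (h' p) p)
    (φ φ' : ℝ → ℝ)
    (hφc : ContinuousOn φ (Set.Icc ω ρbar))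
    (hφd : ∀ y ∈ Set.Ioo ω ρbar, HasDerivAt φ (φ' y) y)
    (hφω : φ ω = plow)
    (hineq : ∀ y ∈ Set.Ioo ω ρbar, φ y - f' y ≥ (1 / α) * (h' (φ y) * φ' y))
    (hinit : plow * ω - f ω ≥ (1 / α) * h plow) :
    ∀ ρ ∈ Set.Icc ω ρbar,
      plow * ω + (∫ y in ω..ρ, φ y) - f ρ ≥ (1 / α) * h (φ ρ) := by
  intro ρ hρ
  have hsub : Set.Icc ω ρ ⊆ Set.Icc ω ρbar := Set.Icc_subset_Icc_right hρ.2
  have hhc : Continuous h := continuous_iff_continuousAt.2 fun p => (hh p).continuousAt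
  have hfc : Continuous f := continuous_iff_continuousAt.2 fun y => (hf y).continuousAt
  have hgrowth := intervalIntegral.sub_le_integral_of_hasDeriv_right_of_le
    (g := fun y => f y + (1 / α) * h (φ y))
    (g' := fun y => f' y + (1 / α) * (h' (φ y) * φ' y)) (φ := φ) hρ.1
    (hfc.continuousOn.add
      (continuousOn_const.mul (hhc.comp_continuousOn (hφc.mono hsub))))
    (fun y hy => ((hf y).add (((hh (φ y)).comp y
      (hφd y ⟨hy.1, hy.2.trans_le hρ.2⟩)).const_mul (1 / α))).hasDerivWithinAt)
    (hφc.mono hsub).integrableOn_Icc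
    (fun y hy => by linarith [hineq y ⟨hy.1, hy.2.trans_le hρ.2⟩])
  simp only [hφω] at hgrowth
  linarith
end

section
/- Let 0 ≤ ω < u and α > 0 be reals, let F : ℝ → ℝ be continuous and nondecreasing on [ω, u], and let g : ℝ → ℝ satisfy g(t) > 0 for all t. Suppose φ : ℝ → ℝ is differentiable on [ω, u] with φ'(y) = α·(φ(y) − F(y))/g(φ(y)) for all y ∈ [ω, u], and φ(u) ≥ F(u). Then φ(y) ≥ F(y) for all y ∈ [ω, u], and consequently φ is monotone nondecreasing on [ω, u]. -/
/-- Lemma 2: a solution of the pricing-function ODE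
`φ' = α (φ − F)/g(φ)` anchored at or above the (nondecreasing) marginal cost `F`
at the right endpoint stays above `F` on `[ω, u]` and is therefore nondecreasing. -/
theorem stmt9 (ω u α : ℝ) (hω : 0 ≤ ω) (hωu : ω < u) (hα : 0 < α)
    (F : ℝ → ℝ) (hFc : ContinuousOn F (Set.Icc ω u)) (hFmono : MonotoneOn F (Set.Icc ω u))
    (g : ℝ → ℝ) (hg : ∀ t, 0 < g t)
    (φ φ' : ℝ → ℝ)
    (hφd : ∀ y ∈ Set.Icc ω u, HasDerivWithinAt φ (φ' y) (Set.Icc ω u) y)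
    (hode : ∀ y ∈ Set.Icc ω u, φ' y = α * (φ y - F y) / g (φ y))
    (hu : φ u ≥ F u) :
    (∀ y ∈ Set.Icc ω u, φ y ≥ F y) ∧ MonotoneOn φ (Set.Icc ω u) := by
  have hφc : ContinuousOn φ (Set.Icc ω u) := fun y hy => (hφd y hy).continuousWithinAt
  have hderiv : ∀ a b, ω ≤ a → b ≤ u → ∀ x ∈ interior (Set.Icc a b),
      HasDerivWithinAt φ (φ' x) (interior (Set.Icc a b)) x := fun a b ha hb x hx =>
    have hsub := Set.Icc_subset_Icc ha hb
    (hφd x (hsub (interior_subset hx))).mono (interior_subset.trans hsub)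
  have hge : ∀ y ∈ Set.Icc ω u, F y ≤ φ y := by
    intro y hy
    by_contra! hlt
    have hsub : Set.Icc y u ⊆ Set.Icc ω u := Set.Icc_subset_Icc_left hy.1
    have hclosed : IsClosed {x ∈ Set.Icc y u | F x ≤ φ x} :=
      isClosed_Icc.isClosed_le (hFc.mono hsub) (hφc.mono hsub)
    have hcompact : IsCompact {x ∈ Set.Icc y u | F x ≤ φ x} :=
      isCompact_Icc.of_isClosed_subset hclosed (Set.sep_subset _ _)
    obtain ⟨z, ⟨hz, hFz⟩, hmin⟩ :=
      hcompact.exists_isLeast ⟨u, Set.right_mem_Icc.2 hy.2, hu⟩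
    have hanti : AntitoneOn φ (Set.Icc y z) := by
      refine antitoneOn_of_hasDerivWithinAt_nonpos (convex_Icc y z)
        (hφc.mono (Set.Icc_subset_Icc hy.1 hz.2)) (hderiv y z hy.1 hz.2) fun x hx => ?_
      rw [interior_Icc] at hx
      have hxu : x ∈ Set.Icc y u := ⟨hx.1.le, hx.2.le.trans hz.2⟩
      have hxlt : φ x < F x := by
        by_contra! h
        exact hx.2.not_ge (hmin ⟨hxu, h⟩)
      rw [hode x (hsub hxu)]
      exact div_nonpos_of_nonpos_of_nonneg
        (mul_nonpos_of_nonneg_of_nonpos hα.le (sub_nonpos.2 hxlt.le)) (hg _).le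
    have hφz := hanti (Set.left_mem_Icc.2 hz.1) (Set.right_mem_Icc.2 hz.1) hz.1
    linarith [hFmono hy (hsub hz) hz.1]
  refine ⟨hge, monotoneOn_of_hasDerivWithinAt_nonneg (convex_Icc ω u) hφc
    (hderiv ω u le_rfl le_rfl) fun x hx => ?_⟩
  have hx' := interior_subset hx
  rw [hode x hx']
  exact div_nonneg (mul_nonneg hα.le (sub_nonneg.2 (hge x hx'))) (hg _).le
end

section
/- Let 0 ≤ ω < u be reals, let F : ℝ → ℝ, and let g : ℝ → ℝ satisfy g(t) > 0 for all t. Let α₁ > α₂ > 0, and let φ₁, φ₂ : ℝ → ℝ be differentiable on [ω, u] with φᵢ'(y) = αᵢ·(φᵢ(y) − F(y))/g(φᵢ(y)) for all y ∈ [ω, u] and i = 1, 2. Assume φ₁(u) = φ₂(u) and φᵢ(y) > F(y) for all y ∈ [ω, u] and i = 1, 2. Then φ₁(y) < φ₂(y) for all y ∈ [ω, u). -/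
/-- Lemma 3 (comparison in the competitive-ratio parameter): solutions of the
pricing-function ODE with the same terminal value at `u` and staying above the
marginal cost are pointwise strictly decreasing in `α`. -/
theorem stmt10 (ω u : ℝ) (hω : 0 ≤ ω) (hωu : ω < u)
    (F g : ℝ → ℝ) (hg : ∀ t, 0 < g t)
    (α₁ α₂ : ℝ) (hα : α₁ > α₂) (hα₂ : α₂ > 0)
    (φ₁ φ₂ φ₁' φ₂' : ℝ → ℝ)
    (hd₁ : ∀ y ∈ Set.Icc ω u, HasDerivWithinAt φ₁ (φ₁' y) (Set.Icc ω u) y)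
    (hode₁ : ∀ y ∈ Set.Icc ω u, φ₁' y = α₁ * (φ₁ y - F y) / g (φ₁ y))
    (hd₂ : ∀ y ∈ Set.Icc ω u, HasDerivWithinAt φ₂ (φ₂' y) (Set.Icc ω u) y)
    (hode₂ : ∀ y ∈ Set.Icc ω u, φ₂' y = α₂ * (φ₂ y - F y) / g (φ₂ y))
    (hterm : φ₁ u = φ₂ u)
    (habove₁ : ∀ y ∈ Set.Icc ω u, φ₁ y > F y)
    (habove₂ : ∀ y ∈ Set.Icc ω u, φ₂ y > F y) :
    ∀ y ∈ Set.Ico ω u, φ₁ y < φ₂ y := by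
  intro y₀ hy₀
  by_contra! hle
  have hsub : Set.Icc y₀ u ⊆ Set.Icc ω u := Set.Icc_subset_Icc_left hy₀.1
  have hcross : ∀ y ∈ Set.Icc ω u, φ₂ y = φ₁ y → φ₂' y < φ₁' y := by
    intro y hy heq
    rw [hode₁ y hy, hode₂ y hy, heq]
    exact div_lt_div_of_pos_right
      (mul_lt_mul_of_pos_right hα (sub_pos.2 (habove₁ y hy))) (hg _)
  have hright : ∀ {f f' : ℝ → ℝ},
      (∀ y ∈ Set.Icc ω u, HasDerivWithinAt f (f' y) (Set.Icc ω u) y) →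
      ∀ y ∈ Set.Ico y₀ u, HasDerivWithinAt f (f' y) (Set.Ici y) y := by
    intro f f' hf y hy
    exact (hf y (hsub (Set.Ico_subset_Icc_self hy))).mono_of_mem_nhdsWithin
      (Filter.mem_of_superset (Icc_mem_nhdsGE hy.2)
        (Set.Icc_subset_Icc_left (hy₀.1.trans hy.1)))
  have hge : ∀ y ∈ Set.Icc y₀ u, φ₂ y ≤ φ₁ y := fun y hy =>
    image_le_of_deriv_right_lt_deriv_boundary'
      (fun x hx => (hd₂ x (hsub hx)).continuousWithinAt.mono hsub) (hright hd₂) hle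
      (fun x hx => (hd₁ x (hsub hx)).continuousWithinAt.mono hsub) (hright hd₁)
      (fun x hx => hcross x (hsub (Set.Ico_subset_Icc_self hx))) hy
  have hu : u ∈ Set.Icc ω u := Set.right_mem_Icc.2 hωu.le
  have hslope := hasDerivWithinAt_iff_tendsto_slope.1 (((hd₁ u hu).sub (hd₂ u hu)).mono hsub)
  rw [Set.Icc_sdiff_right] at hslope
  have : (nhdsWithin u (Set.Ico y₀ u)).NeBot := by
    rw [nhdsWithin_Ico_eq_nhdsLT hy₀.2]
    infer_instance
  have hnonpos : φ₁' u - φ₂' u ≤ 0 := by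
    refine le_of_tendsto hslope (Filter.eventually_of_mem self_mem_nhdsWithin fun y hy => ?_)
    have h := hge y (Set.Ico_subset_Icc_self hy)
    rw [slope_def_field]
    refine div_nonpos_of_nonneg_of_nonpos ?_ (sub_nonpos.2 hy.2.le)
    simp only [Pi.sub_apply]
    linarith
  linarith [hcross u hu hterm.symm]
end

section
/- Let q, p̲, p̄ be reals with 0 ≤ q < p̲ ≤ p̄. Set α := 1 + ln((p̄ − q)/(p̲ − q)) and ω := 1/α, and define φ(y) := (p̲ − q)·e^{y/ω − 1} + q. Then: (i) α ≥ 1 and 0 < ω ≤ 1; (ii) φ(ω) = p̲; (iii) φ(1) = p̄; (iv) φ'(y) = α·(φ(y) − q) for all y ∈ ℝ; and (v) sup_{z ∈ [0,1]} (p̲·z − q·z) = p̲ − q and (p̲ − q)·ω = (1/α)·(p̲ − q), i.e. the flat-segment condition F_p̲(ω) ≥ (1/α)·h(p̲) holds with equality for the linear cost f(y) = q·y. -/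
/-- Corollary 2 (linear supply cost `f(y) = q y`): the pricing function
`φ(y) = (p̲ − q) e^{y/ω − 1} + q` with `α = 1 + ln((p̄ − q)/(p̲ − q))` and `ω = 1/α`
satisfies the boundary conditions, the ODE `φ' = α (φ − q)`, and the flat-segment
condition with equality. -/
theorem stmt13 (q plow pbar : ℝ) (hq : 0 ≤ q) (h1 : q < plow) (h2 : plow ≤ pbar)
    (α ω : ℝ) (hαdef : α = 1 + Real.log ((pbar - q) / (plow - q)))
    (hωdef : ω = 1 / α)
    (φ : ℝ → ℝ) (hφdef : ∀ y : ℝ, φ y = (plow - q) * Real.exp (y / ω - 1) + q) :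
    (1 ≤ α ∧ 0 < ω ∧ ω ≤ 1) ∧
    φ ω = plow ∧
    φ 1 = pbar ∧
    (∀ y : ℝ, HasDerivAt φ (α * (φ y - q)) y) ∧
    (sSup ((fun z => plow * z - q * z) '' Set.Icc (0 : ℝ) 1) = plow - q ∧
      (plow - q) * ω = (1 / α) * (plow - q)) := by
  have hpos : 0 < plow - q := sub_pos.mpr h1
  have hratio : 1 ≤ (pbar - q) / (plow - q) := by
    rw [le_div_iff₀ hpos]
    linarith
  have hα : 1 ≤ α := by
    rw [hαdef]
    linarith [Real.log_nonneg hratio]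
  have hα0 : 0 < α := by linarith
  have hω0 : 0 < ω := by
    rw [hωdef]
    positivity
  have hω1 : ω ≤ 1 := by
    rw [hωdef, div_le_one hα0]
    exact hα
  have hdiv : ∀ y : ℝ, y / ω = α * y := by
    intro y
    rw [hωdef]
    field_simp
  refine ⟨⟨hα, hω0, hω1⟩, ?_, ?_, ?_, ?_, ?_⟩
  · rw [hφdef, div_self hω0.ne', sub_self, Real.exp_zero]
    ring
  · rw [hφdef, hdiv, mul_one, hαdef, add_sub_cancel_left,
      Real.exp_log (by linarith), mul_div_cancel₀ _ hpos.ne', sub_add_cancel]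
  · intro y
    have hφ : φ = fun y => (plow - q) * Real.exp (α * y - 1) + q := by
      funext y
      rw [hφdef, hdiv]
    have hexp : HasDerivAt (fun y : ℝ => α * y - 1) (α * 1) y :=
      ((hasDerivAt_id y).const_mul α).sub_const 1
    rw [hφ]
    refine ((hexp.exp.const_mul (plow - q)).add_const q).congr_deriv ?_
    ring
  · refine IsGreatest.csSup_eq ⟨⟨1, by simp, by ring⟩, ?_⟩
    rintro _ ⟨z, hz, rfl⟩
    nlinarith [hz.2]
  · rw [hωdef, mul_comm]
end

section
/- Let N be a natural number, v, r : Fin N → ℝ with r_n ≥ 0 for all n, let f : ℝ → ℝ be continuous on [0,1], define h(p) := sup_{z ∈ [0,1]} (p·z − f(z)), and let φ : ℝ → ℝ be nondecreasing with φ(t) ≥ 0 for all t. Define recursively ŷ_0 := 0 and, for n = 1,…,N: x̂_n := 1 if v_n ≥ φ(ŷ_{n−1})·r_n and ŷ_{n−1} + r_n ≤ 1, and x̂_n := 0 otherwise; ŷ_n := ŷ_{n−1} + r_n·x̂_n; and γ̂_n := max(v_n − φ(ŷ_{n−1})·r_n, 0). Let P_n := Σ_{m ≤ n} v_m·x̂_m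 − f(ŷ_n) and D_n := Σ_{m ≤ n} γ̂_m + h(φ(ŷ_n)). Suppose α ≥ 1 and there exists k ≤ N such that P_k ≥ (1/α)·D_k and P_n − P_{n−1} ≥ (1/α)·(D_n − D_{n−1}) for all n with k < n ≤ N. Then for every x : Fin N → {0,1} with Σ_n r_n·x_n ≤ 1, one has Σ_n v_n·x_n − f(Σ_n r_n·x_n) ≤ α·(Σ_n v_n·x̂_n − f(ŷ_N)). -/
/-- The Fenchel–Young inequality for the conjugate over a compact interval. -/
theorem le_sSup_conjugate {f : ℝ → ℝ} {a b : ℝ} (hf : ContinuousOn f (Set.Icc a b))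
    (p : ℝ) {z : ℝ} (hz : z ∈ Set.Icc a b) :
    p * z - f z ≤ sSup ((fun z => p * z - f z) '' Set.Icc a b) :=
  le_csSup (isCompact_Icc.image_of_continuousOn (by fun_prop)).bddAbove
    (Set.mem_image_of_mem _ hz)

/-- A linear inequality between two sequences that holds at `k` and for all later increments
holds at every later index. -/
theorem le_of_le_of_increments_le {P D : ℕ → ℝ} {c : ℝ} {k N : ℕ} (hk : k ≤ N)
    (hinit : c * D k ≤ P k)
    (hstep : ∀ n, k < n → n ≤ N → c * (D n - D (n - 1)) ≤ P n - P (n - 1)) :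
    c * D N ≤ P N := by
  induction N, hk using Nat.le_induction with
  | base => exact hinit
  | succ n hkn ih =>
    have h₁ := ih fun m hkm hmn => hstep m hkm (by lia)
    have h₂ := hstep (n + 1) (by lia) le_rfl
    rw [Nat.add_sub_cancel] at h₂
    linarith

/-- Competitive guarantee of the posted-price mechanism PM_φ: with the online
allocation, utilization, and dual variables defined by the posted-price recursion,
if the online primal/dual objectives satisfy the initial and incremental
inequalities, then the online welfare is at least `1/α` times the offline optimum
of the 0-1 knapsack-type problem. -/
theorem stmt14 (N : ℕ) (v r : Fin N → ℝ) (hr : ∀ n, 0 ≤ r n)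
    (f : ℝ → ℝ) (hf : ContinuousOn f (Set.Icc 0 1))
    (φ : ℝ → ℝ) (hφmono : Monotone φ) (hφpos : ∀ t, 0 ≤ φ t)
    (xhat : Fin N → ℝ) (yhat : ℕ → ℝ) (γhat : Fin N → ℝ)
    (hy0 : yhat 0 = 0)
    (hx : ∀ n : Fin N, xhat n =
      if v n ≥ φ (yhat n.val) * r n ∧ yhat n.val + r n ≤ 1 then 1 else 0)
    (hy : ∀ n : Fin N, yhat (n.val + 1) = yhat n.val + r n * xhat n)
    (hγ : ∀ n : Fin N, γhat n = max (v n - φ (yhat n.val) * r n) 0)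
    (P D : ℕ → ℝ)
    (hP : ∀ n : ℕ, n ≤ N →
      P n = (∑ m : Fin N, if m.val < n then v m * xhat m else 0) - f (yhat n))
    (hD : ∀ n : ℕ, n ≤ N →
      D n = (∑ m : Fin N, if m.val < n then γhat m else 0) +
        sSup ((fun z => φ (yhat n) * z - f z) '' Set.Icc 0 1))
    (α : ℝ) (hα : 1 ≤ α)
    (k : ℕ) (hk : k ≤ N)
    (hinit : P k ≥ (1 / α) * D k)
    (hstep : ∀ n : ℕ, k < n → n ≤ N → P n - P (n - 1) ≥ (1 / α) * (D n - D (n - 1))) :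
    ∀ x : Fin N → ℝ, (∀ n, x n = 0 ∨ x n = 1) → (∑ n, r n * x n) ≤ 1 →
      (∑ n, v n * x n) - f (∑ n, r n * x n) ≤
        α * ((∑ n, v n * xhat n) - f (yhat N)) := by
  intro x hx01 hcap
  have hxhat : ∀ n, 0 ≤ xhat n := fun n => by
    rw [hx n]; split_ifs <;> norm_num
  have hymono : ∀ m ≤ N, ∀ n ≤ m, yhat n ≤ yhat m := by
    intro m hm n hnm
    induction m, hnm using Nat.le_induction with
    | base => rfl
    | succ m _ ih =>
      have := hy ⟨m, hm⟩
      have := mul_nonneg (hr ⟨m, hm⟩) (hxhat ⟨m, hm⟩)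
      have := ih (by lia)
      simp only at *
      linarith
  have hx0 : ∀ n, 0 ≤ x n := fun n => by rcases hx01 n with h | h <;> simp [h]
  have hz : ∑ n, r n * x n ∈ Set.Icc (0 : ℝ) 1 :=
    ⟨Finset.sum_nonneg fun n _ => mul_nonneg (hr n) (hx0 n), hcap⟩
  have hdual : ∑ n, v n * x n ≤ ∑ n, γhat n + φ (yhat N) * ∑ n, r n * x n := by
    rw [Finset.mul_sum, ← Finset.sum_add_distrib]
    refine Finset.sum_le_sum fun n _ => ?_
    have hprice := mul_le_mul_of_nonneg_right
      (hφmono (hymono N le_rfl n.val n.isLt.le)) (hr n)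
    have hγ₀ : 0 ≤ γhat n := hγ n ▸ le_max_right _ _
    have hγ₁ : v n - φ (yhat n.val) * r n ≤ γhat n := hγ n ▸ le_max_left _ _
    rcases hx01 n with h | h <;> simp only [h, mul_zero, mul_one] <;> linarith
  have hconj := le_sSup_conjugate hf (φ (yhat N)) hz
  have hPD := le_of_le_of_increments_le hk hinit hstep
  have hPN := hP N le_rfl
  have hDN := hD N le_rfl
  simp only [Fin.is_lt, if_true] at hPN hDN
  rw [one_div, inv_mul_le_iff₀ (by linarith)] at hPD
  rw [← hPN]
  linarith
end

section
/- Let 0 < ω < u and α ∈ ℝ, let p̲ > 0, and let φ : ℝ → ℝ be differentiable on [ω, u] with φ(y) > 0 and φ'(y) = α·(φ(y) − y)/φ(y) for all y ∈ [ω, u], φ(ω) = p̲, and φ(u) = 1. Suppose t² − α·t + α ≠ 0 for every t in the image of the map y ↦ φ(y)/y on [ω, u]. Then ∫_{p̲/ω}^{1/u} (−t/(t² − α·t + α)) dt = ln(u/ω). -/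
/-- Equation (43) of the quadratic-cost case study: a positive solution of
`φ'(y) = α (φ(y) − y)/φ(y)` on `[ω, u]` with `φ(ω) = p̲` and `φ(u) = 1`
satisfies the integral relation obtained by the homogeneous substitution
`t = φ(y)/y`. -/
theorem stmt15 (ω u α plow : ℝ) (hω : 0 < ω) (hωu : ω < u) (hplow : 0 < plow)
    (φ φ' : ℝ → ℝ)
    (hd : ∀ y ∈ Set.Icc ω u, HasDerivWithinAt φ (φ' y) (Set.Icc ω u) y)
    (hpos : ∀ y ∈ Set.Icc ω u, 0 < φ y)
    (hode : ∀ y ∈ Set.Icc ω u, φ' y = α * (φ y - y) / φ y)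
    (hbω : φ ω = plow) (hbu : φ u = 1)
    (hne : ∀ y ∈ Set.Icc ω u, (φ y / y) ^ 2 - α * (φ y / y) + α ≠ 0) :
    (∫ t in (plow / ω)..(1 / u), -t / (t ^ 2 - α * t + α)) = Real.log (u / ω) := by
  have huIcc : Set.uIcc ω u = Set.Icc ω u := Set.uIcc_of_le hωu.le
  have hy : ∀ y ∈ Set.Icc ω u, 0 < y := fun y h => hω.trans_le h.1
  have hφ : ContinuousOn φ (Set.Icc ω u) := fun y h => (hd y h).continuousWithinAt
  have hφ' : ContinuousOn φ' (Set.Icc ω u) :=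
    ((continuousOn_const.mul (hφ.sub continuousOn_id)).div hφ
      fun y h => (hpos y h).ne').congr hode
  have hsub := intervalIntegral.integral_comp_mul_deriv'' (a := ω) (b := u)
    (f := fun y => φ y / y) (f' := fun y => (φ' y * y - φ y) / y ^ 2)
    (g := fun t => -t / (t ^ 2 - α * t + α))
    (by
      rw [huIcc]
      exact hφ.div continuousOn_id fun y h => (hy y h).ne')
    (by
      intro y h
      rw [min_eq_left hωu.le, max_eq_right hωu.le] at h
      have hm := Set.Ioo_subset_Icc_self h
      have hderiv := (hd y hm).hasDerivAt (Icc_mem_nhds h.1 h.2)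
      simpa using (hderiv.fun_div (hasDerivAt_id' y) (hy y hm).ne').hasDerivWithinAt)
    (by
      rw [huIcc]
      exact ((hφ'.mul continuousOn_id).sub hφ).div (continuousOn_id.pow 2)
        fun y h => pow_ne_zero 2 (hy y h).ne')
    (by
      rw [huIcc]
      refine ContinuousOn.div (by fun_prop) (by fun_prop) ?_
      rintro _ ⟨y, h, rfl⟩
      exact hne y h)
  simp only [hbω, hbu] at hsub
  rw [← hsub, ← integral_one_div_of_pos hω (hω.trans hωu)]
  refine intervalIntegral.integral_congr fun y h => ?_
  rw [huIcc] at h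
  have hy0 := (hy y h).ne'
  have hφ0 := (hpos y h).ne'
  have hden := hne y h
  have hderiv : (φ' y * y - φ y) / y ^ 2
      = -((φ y / y) ^ 2 - α * (φ y / y) + α) / (φ y / y * y) := by
    rw [hode y h]
    field_simp
    ring
  simp only [Function.comp_apply, hderiv]
  generalize (φ y / y) ^ 2 - α * (φ y / y) + α = d at hden
  field_simp
end
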